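/- For every constant C > 0 and every x ∈ ℝ³ with x ≠ 0, the Laplacian of the softened Coulomb potential, i.e. the sum over j = 1,2,3 of the second partial derivatives ∂²V_P/∂x_j²(x), equals e^{-C/|x|} (C²/|x|⁵ − 2C/|x|⁴). -/

import Mathlib

open Real Classical

/-- The softened Coulomb potential on ℝ³. -/
noncomputable def VP (C : ℝ) (x : EuclideanSpace ℝ (Fin 3)) : ℝ :=
  if x = 0 then 0 else Real.exp (-C / ‖x‖) / ‖x‖

theorem hasFDerivAt_norm_of_ne_zero {E : Type*} [NormedAddCommGroup E] [InnerProductSpace ℝ E]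
    {x : E} (hx : x ≠ 0) :
    HasFDerivAt (fun y : E => ‖y‖) (‖x‖⁻¹ • innerSL ℝ x) x := by
  have hr : ‖x‖ ≠ 0 := norm_ne_zero_iff.mpr hx
  have h := (hasStrictFDerivAt_norm_sq x).hasFDerivAt.sqrt (pow_ne_zero 2 hr)
  simp only [Real.sqrt_sq (norm_nonneg _)] at h
  convert h using 1
  ext v
  simp
  field_simp

theorem HasDerivAt.hasFDerivAt_comp_norm {E : Type*} [NormedAddCommGroup E]
    [InnerProductSpace ℝ E] {f : ℝ → ℝ} {f' : ℝ} {x : E} (hx : x ≠ 0)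
    (hf : HasDerivAt f f' ‖x‖) :
    HasFDerivAt (fun y : E => f ‖y‖) ((f' / ‖x‖) • innerSL ℝ x) x := by
  have h := hf.comp_hasFDerivAt x (hasFDerivAt_norm_of_ne_zero hx)
  rwa [smul_smul, ← div_eq_mul_inv] at h

theorem hasDerivAt_exp_neg_div (C : ℝ) {r : ℝ} (hr : r ≠ 0) :
    HasDerivAt (fun s => Real.exp (-C / s)) (Real.exp (-C / r) * (C / r ^ 2)) r := by
  refine ((hasDerivAt_const r (-C)).div (hasDerivAt_id r) hr).exp.congr_deriv ?_
  simp

theorem hasDerivAt_exp_neg_div_div (C : ℝ) {r : ℝ} (hr : r ≠ 0) :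
    HasDerivAt (fun s => Real.exp (-C / s) / s)
      (Real.exp (-C / r) * (C / r ^ 3 - 1 / r ^ 2)) r := by
  refine ((hasDerivAt_exp_neg_div C hr).div (hasDerivAt_id r) hr).congr_deriv ?_
  simp only [id]
  field_simp

theorem hasDerivAt_exp_neg_div_mul (C : ℝ) {r : ℝ} (hr : r ≠ 0) :
    HasDerivAt (fun s => Real.exp (-C / s) * (C / s ^ 3 - 1 / s ^ 2) / s)
      (Real.exp (-C / r) * (C ^ 2 / r ^ 6 - 5 * C / r ^ 5 + 3 / r ^ 4)) r := by
  refine (((hasDerivAt_exp_neg_div C hr).mul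
    (((hasDerivAt_const r C).div (hasDerivAt_pow 3 r) (pow_ne_zero 3 hr)).sub
      ((hasDerivAt_const r 1).div (hasDerivAt_pow 2 r) (pow_ne_zero 2 hr)))).div
    (hasDerivAt_id r) hr).congr_deriv ?_
  simp
  field_simp
  ring

theorem fderiv_VP_single (C : ℝ) {y : EuclideanSpace ℝ (Fin 3)} (hy : y ≠ 0) (j : Fin 3) :
    fderiv ℝ (VP C) y (EuclideanSpace.single j (1 : ℝ)) =
      Real.exp (-C / ‖y‖) * (C / ‖y‖ ^ 3 - 1 / ‖y‖ ^ 2) / ‖y‖ * y j := by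
  have heq : VP C =ᶠ[nhds y] fun z => Real.exp (-C / ‖z‖) / ‖z‖ := by
    filter_upwards [isOpen_ne.mem_nhds hy] with z hz
    exact if_neg hz
  rw [heq.fderiv_eq, ((hasDerivAt_exp_neg_div_div C
    (norm_ne_zero_iff.mpr hy)).hasFDerivAt_comp_norm hy).fderiv]
  simp [EuclideanSpace.inner_single_right]

theorem fderiv_fderiv_VP_single (C : ℝ) {x : EuclideanSpace ℝ (Fin 3)} (hx : x ≠ 0)
    (j : Fin 3) :
    fderiv ℝ (fun y => fderiv ℝ (VP C) y (EuclideanSpace.single j (1 : ℝ))) x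
        (EuclideanSpace.single j (1 : ℝ)) =
      Real.exp (-C / ‖x‖) * (C / ‖x‖ ^ 3 - 1 / ‖x‖ ^ 2) / ‖x‖ +
        Real.exp (-C / ‖x‖) * (C ^ 2 / ‖x‖ ^ 6 - 5 * C / ‖x‖ ^ 5 + 3 / ‖x‖ ^ 4) / ‖x‖ *
          x j ^ 2 := by
  have heq : (fun y => fderiv ℝ (VP C) y (EuclideanSpace.single j (1 : ℝ))) =ᶠ[nhds x]
      fun y => Real.exp (-C / ‖y‖) * (C / ‖y‖ ^ 3 - 1 / ‖y‖ ^ 2) / ‖y‖ * y j := by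
    filter_upwards [isOpen_ne.mem_nhds hx] with y hy
    exact fderiv_VP_single C hy j
  have hradial := (hasDerivAt_exp_neg_div_mul C
    (norm_ne_zero_iff.mpr hx)).hasFDerivAt_comp_norm hx
  have hcoord : HasFDerivAt (fun y : EuclideanSpace ℝ (Fin 3) => y j)
      (EuclideanSpace.proj j : EuclideanSpace ℝ (Fin 3) →L[ℝ] ℝ) x :=
    (EuclideanSpace.proj j : EuclideanSpace ℝ (Fin 3) →L[ℝ] ℝ).hasFDerivAt
  rw [heq.fderiv_eq, (hradial.fun_mul hcoord).fderiv]
  simp [EuclideanSpace.inner_single_right]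
  ring

theorem softened_coulomb_laplacian (C : ℝ) (hC : 0 < C)
    (x : EuclideanSpace ℝ (Fin 3)) (hx : x ≠ 0) :
    ∑ j : Fin 3,
        fderiv ℝ (fun y => fderiv ℝ (VP C) y (EuclideanSpace.single j (1 : ℝ))) x
          (EuclideanSpace.single j (1 : ℝ)) =
      Real.exp (-C / ‖x‖) * (C ^ 2 / ‖x‖ ^ 5 - 2 * C / ‖x‖ ^ 4) := by
  have hr : ‖x‖ ≠ 0 := norm_ne_zero_iff.mpr hx
  simp only [fderiv_fderiv_VP_single C hx]
  rw [Finset.sum_add_distrib, ← Finset.mul_sum, ← EuclideanSpace.real_norm_sq_eq]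
  simp only [Finset.sum_const, Finset.card_univ, Fintype.card_fin, nsmul_eq_mul]
  push_cast
  field_simp
  ring
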